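/- arXiv:0908.1749 — 2 statements merged into one kernel-verified Lean document; each statement's English description precedes it below -/
import Mathlib

section
/- Let e ≥ 2 and r ≥ 1 be integers and let s ∈ ℤ. For every strictly decreasing sequence t_1 > t_2 > … of integers such that t_i = s + 1 − i for all sufficiently large i, there exist a unique r-multipartition λ and a unique multicharge s̃ ∈ ℤ^r with s̃_1 + … + s̃_r = s such that {t_1, t_2, …} = B_r(λ, s̃). -/
noncomputable section

/-- The field `ℚ(q)` of rational functions. -/
abbrev K : Type := RatFunc ℚ

/-- The element `q` of `ℚ(q)`. -/
def qK : K := RatFunc.X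

/-- `a_{r'}(t)`: the unique element of `{1,…,e}` congruent to `t` modulo `e`
(this does not depend on `r'`). -/
def aFun (e t : ℤ) : ℤ := (t - 1) % e + 1

/-- `b_{r'}(t)`: the unique element of `{1,…,r'}` such that
`t = a_{r'}(t) + e (b_{r'}(t) − 1) − e r' m` for some integer `m`. -/
def bFun (e r t : ℤ) : ℤ := (t - 1) % (e * r) / e + 1

/-- `m_{r'}(t)`: the unique integer with
`t = a_{r'}(t) + e (b_{r'}(t) − 1) − e r' m_{r'}(t)`. -/
def mFun (e r t : ℤ) : ℤ := (aFun e t + e * (bFun e r t - 1) - t) / (e * r)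

/-- A partition: a weakly decreasing sequence of naturals that is eventually zero.
`part i` denotes `λ_{i+1}` (i.e. indexing is 0-based). -/
structure PartitionSeq where
  part : ℕ → ℕ
  antitone' : ∀ i j : ℕ, i ≤ j → part j ≤ part i
  finite' : ∃ N : ℕ, ∀ i : ℕ, N ≤ i → part i = 0

/-- `β̌^{(k)}_i` (with `k` and `i` 0-based): writing
`β = λ^{(k+1)}_{i+1} + s̃_{k+1} + 1 − (i+1)` as `a − e·m` with `a ∈ {1,…,e}`,
this is `a + e·k − e·r·m`. -/
def checkBeta (e : ℤ) (r : ℕ) (lam : Fin r → PartitionSeq) (s : Fin r → ℤ)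
    (k : Fin r) (i : ℕ) : ℤ :=
  let β : ℤ := ((lam k).part i : ℤ) + s k - i
  aFun e β + e * (k : ℕ) - e * r * ((aFun e β - β) / e)

/-- The set `B_r(λ, s̃)` of all `β̌^{(k)}_i`. -/
def Bset (e : ℤ) (r : ℕ) (lam : Fin r → PartitionSeq) (s : Fin r → ℤ) : Set ℤ :=
  Set.range fun p : Fin r × ℕ => checkBeta e r lam s p.1 p.2

/-- The `β`-numbers of a partition with charge `c`. -/
def betaSeq (l : PartitionSeq) (c : ℤ) (i : ℕ) : ℤ := (l.part i : ℤ) + c - i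

theorem betaSeq_strictAnti (l : PartitionSeq) (c : ℤ) : StrictAnti (betaSeq l c) := by
  refine strictAnti_nat_of_succ_lt fun i => ?_
  have h := l.antitone' i (i + 1) (Nat.le_succ i)
  unfold betaSeq
  push_cast
  omega

theorem betaSeq_eventually (l : PartitionSeq) (c : ℤ) :
    ∃ I : ℕ, ∀ i : ℕ, I ≤ i → betaSeq l c i = c - i := by
  obtain ⟨N, hN⟩ := l.finite'
  exact ⟨N, fun i hi => by simp [betaSeq, hN i hi]⟩

theorem PartitionSeq.ext_part {l l' : PartitionSeq} (h : ∀ i, l.part i = l'.part i) :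
    l = l' := by
  cases l
  cases l'
  congr
  exact funext h

theorem StrictAnti.eq_of_range_eq {b b' : ℕ → ℤ} (hb : StrictAnti b) (hb' : StrictAnti b')
    (h : Set.range b = Set.range b') : b = b' := by
  refine (StrictMono.range_inj (β := ℕ) (γ := ℤᵒᵈ) (f := fun i => OrderDual.toDual (b i))
    (g := fun i => OrderDual.toDual (b' i)) (fun i j hij => hb hij) (fun i j hij => hb' hij)).1 h

theorem betaSeq_injective {l l' : PartitionSeq} {c c' : ℤ}
    (h : Set.range (betaSeq l c) = Set.range (betaSeq l' c')) : l = l' ∧ c = c' := by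
  have hb := (betaSeq_strictAnti l c).eq_of_range_eq (betaSeq_strictAnti l' c') h
  obtain ⟨I, hI⟩ := betaSeq_eventually l c
  obtain ⟨J, hJ⟩ := betaSeq_eventually l' c'
  have hc : c = c' := by
    have h1 := hI (max I J) (le_max_left _ _)
    have h2 := hJ (max I J) (le_max_right _ _)
    rw [hb] at h1
    omega
  refine ⟨PartitionSeq.ext_part fun i => ?_, hc⟩
  have := congrFun hb i
  unfold betaSeq at this
  omega

/-- A strictly decreasing integer sequence drops by at least `j - i` between `i` and `j`. -/
theorem StrictAnti.add_le_add_of_le {b : ℕ → ℤ} (hb : StrictAnti b) {i j : ℕ} (hij : i ≤ j) :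
    b j + j ≤ b i + i := by
  refine antitone_nat_of_succ_le (f := fun n : ℕ => b n + n) (fun n => ?_) hij
  have := hb (Nat.lt_add_one n)
  push_cast
  omega

theorem StrictAnti.eventually_eq_sub {b : ℕ → ℤ} (hb : StrictAnti b) {L : ℤ}
    (hL : ∀ x ≤ L, x ∈ Set.range b) : ∃ (c : ℤ) (I : ℕ), ∀ i : ℕ, I ≤ i → b i = c - i := by
  obtain ⟨I, hI⟩ : ∃ I : ℕ, b I ≤ L := by
    refine ⟨(b 0 - L).toNat, ?_⟩
    have := hb.add_le_add_of_le (Nat.zero_le (b 0 - L).toNat)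
    omega
  refine ⟨b I + I, I, fun i hi => ?_⟩
  induction i, hi using Nat.le_induction with
  | base => ring
  | succ i hi ih =>
    have hle := hb.antitone hi
    obtain ⟨j, hj⟩ := hL (b i - 1) (by omega)
    have hij : i < j := hb.lt_iff_gt.1 (by omega)
    have h1 := hb.antitone (Nat.succ_le_of_lt hij)
    have h2 := hb (Nat.lt_add_one i)
    push_cast
    simp only [Nat.succ_eq_add_one] at h1
    omega

theorem exists_strictAnti_range {S : Set ℤ} {L U : ℤ} (hL : ∀ x ≤ L, x ∈ S)
    (hU : ∀ x ∈ S, x ≤ U) : ∃ b : ℕ → ℤ, StrictAnti b ∧ Set.range b = S := by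
  let P : ℕ → Prop := fun n => U - n ∈ S
  have hP : {n | P n}.Infinite := by
    refine Set.infinite_of_forall_exists_gt fun n => ⟨n + 1 + (U - L).toNat, ?_, by omega⟩
    exact hL _ (by push_cast; omega)
  refine ⟨fun i => U - Nat.nth P i, fun i j hij => ?_, ?_⟩
  · have : Nat.nth P i < Nat.nth P j := Nat.nth_strictMono hP hij
    dsimp only
    omega
  · ext x
    constructor
    · rintro ⟨i, rfl⟩
      exact Nat.nth_mem_of_infinite hP i
    · intro hx
      have hxU := hU x hx
      have : (U - x).toNat ∈ Set.range (Nat.nth P) := by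
        rw [Nat.range_nth_of_infinite hP]
        change U - ((U - x).toNat : ℤ) ∈ S
        rwa [Int.toNat_of_nonneg (by omega), sub_sub_cancel]
      obtain ⟨i, hi⟩ := this
      exact ⟨i, by dsimp only; omega⟩

theorem exists_range_betaSeq {S : Set ℤ} {L U : ℤ} (hL : ∀ x ≤ L, x ∈ S)
    (hU : ∀ x ∈ S, x ≤ U) : ∃ (l : PartitionSeq) (c : ℤ), Set.range (betaSeq l c) = S := by
  obtain ⟨b, hb, rfl⟩ := exists_strictAnti_range hL hU
  obtain ⟨c, I, hI⟩ := hb.eventually_eq_sub hL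
  have hnonneg : ∀ i : ℕ, 0 ≤ b i + i - c := fun i => by
    have h1 := hb.add_le_add_of_le (le_max_left i I)
    have h2 := hI _ (le_max_right i I)
    omega
  refine ⟨⟨fun i => (b i + i - c).toNat, fun i j hij => ?_, I, fun i hi => ?_⟩, c, ?_⟩
  · have := hb.add_le_add_of_le hij
    omega
  · have := hI i hi
    omega
  · congr 1
    funext i
    have := hnonneg i
    simp only [betaSeq]
    omega

/-- Counting the elements of the range of an eventually consecutive sequence above a
sufficiently negative bound. -/
theorem StrictAnti.card_range_inter_Ioi {b : ℕ → ℤ} (hb : StrictAnti b) {c : ℤ} {I : ℕ}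
    (hI : ∀ i : ℕ, I ≤ i → b i = c - i) {L : ℤ} (hL : L ≤ c - I) :
    Finite ↥(Set.range b ∩ Set.Ioi L) ∧ (Nat.card ↥(Set.range b ∩ Set.Ioi L) : ℤ) = c - L := by
  have hn : ((c - L).toNat : ℤ) = c - L := Int.toNat_of_nonneg (by omega)
  have hbn : b (c - L).toNat = L := by
    rw [hI _ (by omega)]
    omega
  have heq : Set.range b ∩ Set.Ioi L = ((Finset.range (c - L).toNat).image b : Finset ℤ) := by
    ext x
    simp only [Set.mem_inter_iff, Set.mem_range, Set.mem_Ioi, Finset.coe_image, Set.mem_image,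
      Finset.coe_range, Set.mem_Iio]
    constructor
    · rintro ⟨⟨i, rfl⟩, hi⟩
      exact ⟨i, hb.lt_iff_gt.1 (by rw [hbn]; exact hi), rfl⟩
    · rintro ⟨i, hi, rfl⟩
      exact ⟨⟨i, rfl⟩, by have := hb hi; rwa [hbn] at this⟩
  rw [heq]
  refine ⟨inferInstance, ?_⟩
  rw [Nat.card_coe_set_eq, Set.ncard_coe_finset, Finset.card_image_of_injective _ hb.injective,
    Finset.card_range, hn]

/-- The map sending `β = a - e m` on the runner `k` to `a + e k - e r m`. -/
def runnerMap (e : ℤ) (r : ℕ) (k : Fin r) (β : ℤ) : ℤ :=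
  aFun e β + e * (k : ℕ) - e * r * ((aFun e β - β) / e)

theorem runnerMap_eq {e : ℤ} (he : 0 < e) (r : ℕ) (k : Fin r) (β : ℤ) :
    runnerMap e r k β = (β - 1) % e + 1 + e * ((k : ℕ) + r * ((β - 1) / e)) := by
  have h : aFun e β - β = e * (-((β - 1) / e)) := by
    have := Int.emod_add_mul_ediv (β - 1) e
    unfold aFun
    linarith
  rw [runnerMap, h, Int.mul_ediv_cancel_left _ he.ne', aFun]
  ring

theorem runnerMap_sub_one {e : ℤ} (he : 0 < e) {r : ℕ} (k : Fin r) (β : ℤ) :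
    (runnerMap e r k β - 1) % e = (β - 1) % e ∧
      (runnerMap e r k β - 1) / e = (k : ℕ) + r * ((β - 1) / e) := by
  have h : runnerMap e r k β - 1 = (β - 1) % e + e * ((k : ℕ) + r * ((β - 1) / e)) := by
    rw [runnerMap_eq he]
    ring
  rw [h, Int.add_mul_emod_self_left, Int.add_mul_ediv_left _ _ he.ne', Int.emod_emod_of_dvd _ dvd_rfl,
    Int.ediv_eq_zero_of_lt (Int.emod_nonneg _ he.ne') (Int.emod_lt_of_pos _ he)]
  simp

theorem runnerMap_injective {e : ℤ} (he : 0 < e) {r : ℕ} {k k' : Fin r} {β β' : ℤ}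
    (h : runnerMap e r k β = runnerMap e r k' β') : k = k' ∧ β = β' := by
  obtain ⟨h1, h2⟩ := runnerMap_sub_one he k β
  obtain ⟨h3, h4⟩ := runnerMap_sub_one he k' β'
  rw [h] at h1 h2
  have hmod := h1.symm.trans h3
  have hdiv := h2.symm.trans h4
  have hk := k.isLt
  have hk' := k'.isLt
  have hr : (0 : ℤ) < r := by omega
  have hkk : (k : ℕ) = (k' : ℕ) := by
    have := congrArg (· % (r : ℤ)) hdiv
    simp only [Int.add_mul_emod_self_left] at this
    rw [Int.emod_eq_of_lt (by omega) (by omega), Int.emod_eq_of_lt (by omega) (by omega)] at this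
    exact_mod_cast this
  refine ⟨Fin.ext hkk, ?_⟩
  rw [hkk] at hdiv
  have hd := mul_left_cancel₀ hr.ne' (add_left_cancel hdiv)
  have e1 := Int.emod_add_mul_ediv (β - 1) e
  have e2 := Int.emod_add_mul_ediv (β' - 1) e
  rw [hmod, hd] at e1
  linarith

theorem runnerMap_surjective {e : ℤ} (he : 0 < e) {r : ℕ} (hr : 1 ≤ r) (x : ℤ) :
    ∃ (k : Fin r) (β : ℤ), runnerMap e r k β = x := by
  have hr' : (0 : ℤ) < r := by omega
  have h0 := Int.emod_nonneg ((x - 1) / e) hr'.ne'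
  have h1 := Int.emod_lt_of_pos ((x - 1) / e) hr'
  refine ⟨⟨((x - 1) / e % r).toNat, by omega⟩, (x - 1) % e + e * ((x - 1) / e / r) + 1, ?_⟩
  rw [runnerMap_eq he, add_sub_cancel_right, Int.add_mul_emod_self_left,
    Int.add_mul_ediv_left _ _ he.ne', Int.emod_emod_of_dvd _ dvd_rfl,
    Int.ediv_eq_zero_of_lt (Int.emod_nonneg _ he.ne') (Int.emod_lt_of_pos _ he), zero_add,
    Int.toNat_of_nonneg h0, Int.emod_add_mul_ediv]
  linarith [Int.emod_add_mul_ediv (x - 1) e]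

theorem mul_lt_iff_lt_sub_one_ediv {e : ℤ} (he : 0 < e) (n x : ℤ) :
    e * n < x ↔ n ≤ (x - 1) / e := by
  rw [Int.le_ediv_iff_mul_le he, mul_comm]
  omega

theorem lt_runnerMap_iff {e : ℤ} (he : 0 < e) {r : ℕ} (k : Fin r) (β n : ℤ) :
    e * (r * n) < runnerMap e r k β ↔ e * n < β := by
  have hk := k.isLt
  rw [mul_lt_iff_lt_sub_one_ediv he, mul_lt_iff_lt_sub_one_ediv he, (runnerMap_sub_one he k β).2]
  constructor
  · intro h
    by_contra! hlt
    nlinarith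
  · intro h
    nlinarith

theorem range_eq_Bset_iff {e : ℤ} (he : 0 < e) {r : ℕ} (hr : 1 ≤ r) (T : Set ℤ)
    (lam : Fin r → PartitionSeq) (c : Fin r → ℤ) :
    T = Bset e r lam c ↔ ∀ k, Set.range (betaSeq (lam k) (c k)) = runnerMap e r k ⁻¹' T := by
  have hB : ∀ k β, runnerMap e r k β ∈ Bset e r lam c ↔ β ∈ Set.range (betaSeq (lam k) (c k)) := by
    intro k β
    constructor
    · rintro ⟨⟨k', i⟩, h⟩
      obtain ⟨rfl, rfl⟩ :=
        runnerMap_injective he (show runnerMap e r k' (betaSeq (lam k') (c k') i) = _ from h)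
      exact ⟨i, rfl⟩
    · rintro ⟨i, rfl⟩
      exact ⟨(k, i), rfl⟩
  constructor
  · rintro rfl k
    ext β
    exact (hB k β).symm
  · intro h
    ext x
    obtain ⟨k, β, rfl⟩ := runnerMap_surjective he hr x
    rw [hB, h, Set.mem_preimage]

theorem card_inter_Ioi_eq_sum {e : ℤ} (he : 0 < e) {r : ℕ} (hr : 1 ≤ r) (T : Set ℤ) (n : ℤ)
    (hfin : ∀ k : Fin r, Finite ↥(runnerMap e r k ⁻¹' T ∩ Set.Ioi (e * n))) :
    Nat.card ↥(T ∩ Set.Ioi (e * (r * n))) =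
      ∑ k : Fin r, Nat.card ↥(runnerMap e r k ⁻¹' T ∩ Set.Ioi (e * n)) := by
  rw [← Nat.card_sigma]
  symm
  refine Nat.card_eq_of_bijective
    (fun p : (k : Fin r) × ↥(runnerMap e r k ⁻¹' T ∩ Set.Ioi (e * n)) =>
      (⟨runnerMap e r p.1 p.2, p.2.2.1, (lt_runnerMap_iff he _ _ _).2 p.2.2.2⟩ :
        ↥(T ∩ Set.Ioi (e * (r * n))))) ⟨?_, ?_⟩
  · rintro ⟨k, β, hβ⟩ ⟨k', β', hβ'⟩ h
    obtain ⟨rfl, rfl⟩ := runnerMap_injective he (congrArg Subtype.val h)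
    rfl
  · rintro ⟨x, hx, hlt⟩
    obtain ⟨k, β, rfl⟩ := runnerMap_surjective he hr x
    exact ⟨⟨k, β, hx, (lt_runnerMap_iff he _ _ _).1 hlt⟩, rfl⟩

theorem sum_charge_eq {e : ℤ} (he : 0 < e) {r : ℕ} (hr : 1 ≤ r) {s : ℤ} {t : ℕ → ℤ}
    (ht : StrictAnti t) (hstab : ∃ I : ℕ, ∀ i : ℕ, I ≤ i → t i = s - (i : ℤ))
    {lam : Fin r → PartitionSeq} {c : Fin r → ℤ}
    (h : ∀ k, Set.range (betaSeq (lam k) (c k)) = runnerMap e r k ⁻¹' Set.range t) :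
    ∑ k, c k = s := by
  obtain ⟨I, hI⟩ := hstab
  choose J hJ using fun k => betaSeq_eventually (lam k) (c k)
  obtain ⟨n, hn0, hns, hnk⟩ : ∃ n : ℤ, n ≤ 0 ∧ n ≤ s - I ∧ ∀ k, n ≤ c k - J k := by
    have hlow : ∀ᶠ n : ℤ in Filter.atBot, n ≤ 0 ∧ n ≤ s - I ∧ ∀ k, n ≤ c k - J k :=
      (Filter.eventually_le_atBot _).and ((Filter.eventually_le_atBot _).and
        (Filter.eventually_all.2 fun k => Filter.eventually_le_atBot _))
    exact hlow.exists
  have hr' : (1 : ℤ) ≤ r := by exact_mod_cast hr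
  have hen : e * n ≤ n := by nlinarith
  have hrn : r * n ≤ n := by nlinarith
  have hern : e * (r * n) ≤ n := by nlinarith
  have hk := fun k => (betaSeq_strictAnti (lam k) (c k)).card_range_inter_Ioi (hJ k)
    (hen.trans (hnk k))
  simp only [h] at hk
  have hcard := card_inter_Ioi_eq_sum he hr (Set.range t) n fun k => (hk k).1
  have hs := (ht.card_range_inter_Ioi hI (hern.trans hns)).2
  rw [hcard] at hs
  push_cast at hs
  simp only [(hk _).2, Finset.sum_sub_distrib, Finset.sum_const, Finset.card_univ,
    Fintype.card_fin, nsmul_eq_mul] at hs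
  linarith

theorem exists_range_betaSeq_eq_preimage {e : ℤ} (he : 0 < e) {r : ℕ} {s : ℤ} {t : ℕ → ℤ}
    (ht : StrictAnti t) (hstab : ∃ I : ℕ, ∀ i : ℕ, I ≤ i → t i = s - (i : ℤ)) (k : Fin r) :
    ∃ (l : PartitionSeq) (c : ℤ),
      Set.range (betaSeq l c) = runnerMap e r k ⁻¹' Set.range t := by
  obtain ⟨I, hI⟩ := hstab
  have hr : (1 : ℤ) ≤ r := by have := k.isLt; omega
  have hlow : ∀ y ≤ s - I, y ∈ Set.range t := fun y hy =>
    ⟨(s - y).toNat, by rw [hI _ (by omega)]; omega⟩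
  refine exists_range_betaSeq (L := e * min 0 (s - I)) (U := e * max 0 (t 0))
    (fun x hx => hlow _ ?_) (fun x hx => ?_)
  · have h := mt (lt_runnerMap_iff he k x (min 0 (s - I))).1 (by omega)
    have h0 : min 0 (s - (I : ℤ)) ≤ 0 := min_le_left _ _
    have h1 : min 0 (s - (I : ℤ)) ≤ s - I := min_le_right _ _
    have h2 : r * min 0 (s - (I : ℤ)) ≤ min 0 (s - (I : ℤ)) := by nlinarith
    nlinarith
  · obtain ⟨i, hi⟩ := hx
    have hle := ht.antitone (Nat.zero_le i)
    by_contra! hlt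
    have h := (lt_runnerMap_iff he k x (max 0 (t 0))).2 hlt
    have h0 : 0 ≤ max 0 (t 0) := le_max_left _ _
    have h1 : t 0 ≤ max 0 (t 0) := le_max_right _ _
    have h2 : max 0 (t 0) ≤ r * max 0 (t 0) := by nlinarith
    nlinarith

/-- For `e ≥ 2`, `r ≥ 1` and `s ∈ ℤ`: every strictly decreasing
sequence `t : ℕ → ℤ` with `t i = s − i` for all large `i` (the paper's `t_i = s + 1 − i`)
arises as the enumeration of `B_r(λ, s̃)` for a unique `r`-multipartition `λ` and unique
multicharge `s̃` with `s̃₁ + … + s̃_r = s`. -/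
theorem Bset_unique_preimage (e : ℤ) (he : 2 ≤ e) (r : ℕ) (hr : 1 ≤ r) (s : ℤ)
    (t : ℕ → ℤ) (ht : StrictAnti t)
    (hstab : ∃ I : ℕ, ∀ i : ℕ, I ≤ i → t i = s - (i : ℤ)) :
    ∃! p : (Fin r → PartitionSeq) × (Fin r → ℤ),
      (∑ k, p.2 k) = s ∧ Set.range t = Bset e r p.1 p.2 := by
  have he0 : 0 < e := by omega
  choose lam c hlc using fun k : Fin r => exists_range_betaSeq_eq_preimage he0 ht hstab k
  refine ⟨(lam, c), ⟨sum_charge_eq he0 hr ht hstab hlc, (range_eq_Bset_iff he0 hr _ _ _).2 hlc⟩, ?_⟩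
  rintro ⟨lam', c'⟩ ⟨-, h⟩
  have h' := (range_eq_Bset_iff he0 hr _ _ _).1 h
  have hinj := fun k => betaSeq_injective ((h' k).trans (hlc k).symm)
  exact Prod.ext (funext fun k => (hinj k).1) (funext fun k => (hinj k).2)

end
end

section
/- Let e ≥ 2 be an integer and s ∈ ℤ, and let μ be an e-regular partition. Let l_1 < … < l_t be the indices l ≥ 1 for which ℒ_l ∩ [μ] is non-empty, let a_k = |ℒ_{l_k} ∩ [μ]| and let i_k ∈ ℤ/eℤ be the residue (s + 1 − l_k) mod e, for k = 1,…,t. Write f_{i_t}^{(a_t)} ⋯ f_{i_1}^{(a_1)} |∅⟩ = Σ_ν a_ν |ν⟩ (sum over partitions ν, with a_ν ∈ ℚ(q)). Then a_ν ∈ ℤ[q, q^{−1}] for all ν, a_μ = 1, and a_ν = 0 unless μ ⊵ ν. -/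
noncomputable section

/-- The empty partition. -/
def emptyPart : PartitionSeq := ⟨fun _ => 0, fun _ _ _ => le_refl 0, ⟨0, fun _ _ => rfl⟩⟩

/-- The level-1 Fock space: the `ℚ(q)`-vector space with basis the partitions. -/
abbrev Fock := PartitionSeq →₀ K

/-- `λ` has an addable node at (0-based) row `row`, namely the node
`(row + 1, λ.part row + 1)` in 1-based coordinates. -/
def isAddable (lam : PartitionSeq) (row : ℕ) : Prop :=
  row = 0 ∨ lam.part row < lam.part (row - 1)

instance (lam : PartitionSeq) (row : ℕ) : Decidable (isAddable lam row) := by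
  unfold isAddable; infer_instance

/-- `λ` has a removable node at (0-based) row `row`, namely the node
`(row + 1, λ.part row)` in 1-based coordinates. -/
def isRemovable (lam : PartitionSeq) (row : ℕ) : Prop :=
  lam.part (row + 1) < lam.part row

instance (lam : PartitionSeq) (row : ℕ) : Decidable (isRemovable lam row) := by
  unfold isRemovable; infer_instance

/-- The partition `λ^𝔫` obtained by adding the addable node at row `row` (if the node
is not addable, this returns `λ` itself; this junk value is never used below). -/
def addRow (lam : PartitionSeq) (row : ℕ) : PartitionSeq :=
  if h : isAddable lam row then
    { part := Function.update lam.part row (lam.part row + 1)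
      antitone' := by
        intro i j hij
        rcases eq_or_ne j row with hj | hj
        · rcases eq_or_ne i row with hi | hi
          · rw [Function.update_apply, Function.update_apply, if_pos hj, if_pos hi]
          · rw [Function.update_apply, Function.update_apply, if_pos hj, if_neg hi]
            have hrow : row ≠ 0 := by omega
            rcases h with h0 | hlt
            · exact absurd h0 hrow
            · have h1 : lam.part (row - 1) ≤ lam.part i :=
                lam.antitone' i (row - 1) (by omega)
              omega
        · rcases eq_or_ne i row with hi | hi
          · rw [Function.update_apply, Function.update_apply, if_neg hj, if_pos hi]
            have h2 : lam.part j ≤ lam.part row := lam.antitone' row j (by omega)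
            omega
          · rw [Function.update_apply, Function.update_apply, if_neg hj, if_neg hi]
            exact lam.antitone' i j hij
      finite' := by
        obtain ⟨N, hN⟩ := lam.finite'
        refine ⟨max N (row + 1), fun i hi => ?_⟩
        rw [Function.update_apply, if_neg (by omega)]
        exact hN i (by omega) }
  else lam

/-- A bound beyond which `λ` vanishes. -/
def partBound (lam : PartitionSeq) : ℕ := Classical.choose lam.finite'

/-- The (finite) set of rows at which `λ` has an addable node: every addable row is
`≤ partBound lam`, since rows beyond that are empty. -/
def addableRows (lam : PartitionSeq) : Finset ℕ :=
  (Finset.range (partBound lam + 1)).filter fun row => isAddable lam row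

/-- The residue (in `ℤ/eℤ`) of the addable node of `λ` at row `row`, with charge `s`:
the node is `(row + 1, λ.part row + 1)`, of residue `j − i + s = λ.part row − row + s`. -/
def addRes (e : ℕ) (s : ℤ) (lam : PartitionSeq) (row : ℕ) : ZMod e :=
  (((lam.part row : ℤ) - (row : ℤ) + s : ℤ) : ZMod e)

/-- The residue of the removable node of `λ` at row `row`: the node is
`(row + 1, λ.part row)`, of residue `λ.part row − 1 − row + s`. -/
def remRes (e : ℕ) (s : ℤ) (lam : PartitionSeq) (row : ℕ) : ZMod e :=
  (((lam.part row : ℤ) - 1 - (row : ℤ) + s : ℤ) : ZMod e)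

/-- `N(λ, 𝔫)` for the addable `i`-node `𝔫` at row `row`: the number of addable `i`-nodes
of `λ` above `𝔫` (i.e. in rows `< row`) minus the number of removable `i`-nodes above. -/
def Nval (e : ℕ) (s : ℤ) (i : ZMod e) (lam : PartitionSeq) (row : ℕ) : ℤ :=
  (((Finset.range row).filter fun r' => isAddable lam r' ∧ addRes e s lam r' = i).card : ℤ) -
    (((Finset.range row).filter fun r' => isRemovable lam r' ∧ remRes e s lam r' = i).card : ℤ)

/-- The operator `f_i` on the Fock space:
`f_i |λ⟩ = Σ_{𝔫 addable i-node of λ} q^{N(λ,𝔫)} |λ^𝔫⟩`, extended linearly. -/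
def fOp (e : ℕ) (s : ℤ) (i : ZMod e) (x : Fock) : Fock :=
  x.sum fun lam c =>
    ∑ row ∈ (addableRows lam).filter fun row => addRes e s lam row = i,
      Finsupp.single (addRow lam row) (c * qK ^ Nval e s i lam row)

/-- The quantum integer `[k] = (q^k − q^{−k})/(q − q^{−1})`. -/
def qInt (k : ℕ) : K := (qK ^ (k : ℤ) - qK ^ (-(k : ℤ))) / (qK - qK⁻¹)

/-- The quantum factorial `[a]!`. -/
def qFact (a : ℕ) : K := ∏ k ∈ Finset.range a, qInt (k + 1)

/-- The divided power `f_i^{(a)} = f_i^a / [a]!` applied to a vector. -/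
def divPow (e : ℕ) (s : ℤ) (i : ZMod e) (a : ℕ) (x : Fock) : Fock :=
  (qFact a)⁻¹ • (fOp e s i)^[a] x

/-- `|ℒ_l ∩ [μ]|`: the number of nodes `(i, j)` (1-based) of `μ` with
`i + (e−1)(j−1) = l`.  (All such nodes have `i, j ∈ {1,…,l}`.) -/
def ladderCount (e : ℕ) (mu : PartitionSeq) (l : ℕ) : ℕ :=
  (((Finset.Icc 1 l) ×ˢ (Finset.Icc 1 l)).filter fun p : ℕ × ℕ =>
    p.1 + (e - 1) * (p.2 - 1) = l ∧ p.2 ≤ mu.part (p.1 - 1)).card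

/-! ### Combinatorics of adding sets of rows -/

theorem PartitionSeq.ext_part_s15 {lam nu : PartitionSeq} (h : ∀ r, lam.part r = nu.part r) :
    lam = nu := by
  cases lam; cases nu
  simp only [PartitionSeq.mk.injEq]
  exact funext h

theorem part_eq_zero_of_partBound_le (lam : PartitionSeq) {r : ℕ} (h : partBound lam ≤ r) :
    lam.part r = 0 :=
  Classical.choose_spec lam.finite' r h

theorem mem_addableRows {lam : PartitionSeq} {r : ℕ} :
    r ∈ addableRows lam ↔ isAddable lam r := by
  simp only [addableRows, Finset.mem_filter, Finset.mem_range, and_iff_right_iff_imp]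
  rintro (h | h)
  · omega
  · by_contra hr
    have := part_eq_zero_of_partBound_le lam (r := r - 1) (by omega)
    omega

/-- The rows of the addable `i`-nodes of `lam`. -/
def addSet (e : ℕ) (s : ℤ) (i : ZMod e) (lam : PartitionSeq) : Finset ℕ :=
  (addableRows lam).filter fun row => addRes e s lam row = i

theorem mem_addSet {e : ℕ} {s : ℤ} {i : ZMod e} {lam : PartitionSeq} {r : ℕ} :
    r ∈ addSet e s i lam ↔ isAddable lam r ∧ addRes e s lam r = i := by
  simp [addSet, mem_addableRows]

/-- The partition obtained from `lam` by adding one node in each row of `S` (junk value `lam`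
unless all rows of `S` are addable). -/
def addRows (lam : PartitionSeq) (S : Finset ℕ) : PartitionSeq :=
  if h : ∀ r ∈ S, isAddable lam r then
    { part := fun r => lam.part r + if r ∈ S then 1 else 0
      antitone' := by
        intro i j hij
        have h1 := lam.antitone' i j hij
        rcases eq_or_ne i j with rfl | hne
        · exact le_rfl
        by_cases hj : j ∈ S
        · rcases h j hj with h0 | h0
          · omega
          · have := lam.antitone' i (j - 1) (by omega)
            simp only [hj, if_true]
            omega
        · simp only [hj, if_false]
          omega
      finite' := by
        refine ⟨partBound lam + S.sup id + 1, fun i hi => ?_⟩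
        have hS : i ∉ S := fun hS => by
          have : i ≤ S.sup id := Finset.le_sup (f := id) hS
          omega
        simp [hS, part_eq_zero_of_partBound_le lam (r := i) (by omega)] }
  else lam

theorem addRows_part {lam : PartitionSeq} {S : Finset ℕ} (h : ∀ r ∈ S, isAddable lam r) (r : ℕ) :
    (addRows lam S).part r = lam.part r + if r ∈ S then 1 else 0 := by
  rw [addRows, dif_pos h]

theorem addRow_part {lam : PartitionSeq} {n : ℕ} (h : isAddable lam n) (r : ℕ) :
    (addRow lam n).part r = if r = n then lam.part n + 1 else lam.part r := by
  rw [addRow, dif_pos h]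
  simp [Function.update_apply]

theorem addRows_empty (lam : PartitionSeq) : addRows lam ∅ = lam :=
  PartitionSeq.ext_part_s15 fun r => by rw [addRows_part (by simp)]; simp

theorem isAddable_of_subset_addSet {e : ℕ} {s : ℤ} {i : ZMod e} {lam : PartitionSeq}
    {S : Finset ℕ} (hS : S ⊆ addSet e s i lam) : ∀ r ∈ S, isAddable lam r :=
  fun _ hr => (mem_addSet.1 (hS hr)).1

theorem intCast_zmod_ne_of_sub_eq_one {e : ℕ} (he : 2 ≤ e) {a b : ℤ} (h : a - b = 1) :
    (a : ZMod e) ≠ (b : ZMod e) := by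
  intro hab
  rw [ZMod.intCast_eq_intCast_iff_dvd_sub] at hab
  have : (e : ℤ) ∣ 1 := by
    rw [← h, ← dvd_neg, neg_sub]; exact hab
  have := Int.le_of_dvd one_pos this
  omega

theorem addable_addRows_iff {e : ℕ} (he : 2 ≤ e) {s : ℤ} {i : ZMod e} {lam : PartitionSeq}
    {S : Finset ℕ} (hS : S ⊆ addSet e s i lam) (r : ℕ) :
    (isAddable (addRows lam S) r ∧ addRes e s (addRows lam S) r = i) ↔
      (isAddable lam r ∧ addRes e s lam r = i) ∧ r ∉ S := by
  have hp := addRows_part (isAddable_of_subset_addSet hS)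
  by_cases hr : r ∈ S
  · simp only [hr, not_true_eq_false, and_false, iff_false, not_and]
    intro _ h
    have h2 := (mem_addSet.1 (hS hr)).2
    simp only [addRes, hp, hr, if_true] at h h2
    exact intCast_zmod_ne_of_sub_eq_one he (by push_cast; ring) (h.trans h2.symm)
  · have hres : addRes e s (addRows lam S) r = addRes e s lam r := by
      simp [addRes, hp, hr]
    rw [hres]
    simp only [hr, not_false_eq_true, and_true, and_congr_left_iff]
    intro hi
    simp only [isAddable, hp, hr, if_false, add_zero]
    rcases Nat.eq_zero_or_pos r with h0 | h0
    · simp [h0]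
    · by_cases hr1 : r - 1 ∈ S
      · have h2 := (mem_addSet.1 (hS hr1)).2
        have : lam.part r ≠ lam.part (r - 1) := by
          intro heq
          refine intCast_zmod_ne_of_sub_eq_one he ?_ (h2.trans hi.symm)
          rw [heq]
          push_cast [h0]
          ring
        have := lam.antitone' (r - 1) r (by omega)
        simp only [hr1, if_true]
        omega
      · simp [hr1]

theorem removable_addRows_iff {e : ℕ} (he : 2 ≤ e) {s : ℤ} {i : ZMod e} {lam : PartitionSeq}
    {S : Finset ℕ} (hS : S ⊆ addSet e s i lam) (r : ℕ) :
    (isRemovable (addRows lam S) r ∧ remRes e s (addRows lam S) r = i) ↔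
      (isRemovable lam r ∧ remRes e s lam r = i) ∨ r ∈ S := by
  have hp := addRows_part (isAddable_of_subset_addSet hS)
  by_cases hr : r ∈ S
  · simp only [hr, or_true, iff_true]
    have h2 := (mem_addSet.1 (hS hr)).2
    constructor
    · simp only [isRemovable, hp, hr, if_true]
      have := lam.antitone' r (r + 1) (by omega)
      by_cases hr1 : r + 1 ∈ S
      · rcases (mem_addSet.1 (hS hr1)).1 with h | h
        · omega
        · simp only [Nat.add_sub_cancel] at h
          simp only [hr1, if_true]
          omega
      · simp only [hr1, if_false]
        omega
    · rw [← h2]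
      simp only [remRes, addRes, hp, hr, if_true]
      congr 1
      push_cast
      ring
  · have hres : remRes e s (addRows lam S) r = remRes e s lam r := by
      simp [remRes, hp, hr]
    rw [hres]
    simp only [hr, or_false, and_congr_left_iff]
    intro hi
    simp only [isRemovable, hp, hr, if_false, add_zero]
    by_cases hr1 : r + 1 ∈ S
    · have h2 := (mem_addSet.1 (hS hr1)).2
      have : lam.part r ≠ lam.part (r + 1) + 1 := by
        intro heq
        refine intCast_zmod_ne_of_sub_eq_one he ?_ (hi.trans h2.symm)
        rw [heq]
        push_cast
        ring
      simp only [hr1, if_true]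
      omega
    · simp [hr1]

theorem not_removable_of_mem_addSet {e : ℕ} (he : 2 ≤ e) {s : ℤ} {i : ZMod e}
    {lam : PartitionSeq} {r : ℕ} (hr : r ∈ addSet e s i lam) :
    ¬(isRemovable lam r ∧ remRes e s lam r = i) := fun h =>
  intCast_zmod_ne_of_sub_eq_one he (by ring) ((mem_addSet.1 hr).2.trans h.2.symm)

theorem addSet_addRows {e : ℕ} (he : 2 ≤ e) {s : ℤ} {i : ZMod e} {lam : PartitionSeq}
    {S : Finset ℕ} (hS : S ⊆ addSet e s i lam) :
    addSet e s i (addRows lam S) = addSet e s i lam \ S := by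
  ext r
  rw [mem_addSet, addable_addRows_iff he hS, Finset.mem_sdiff, mem_addSet]

theorem addRow_addRows {e : ℕ} (he : 2 ≤ e) {s : ℤ} {i : ZMod e} {lam : PartitionSeq}
    {S : Finset ℕ} (hS : S ⊆ addSet e s i lam) {n : ℕ} (hn : n ∈ addSet e s i lam \ S) :
    addRow (addRows lam S) n = addRows lam (insert n S) := by
  have hn' := hn
  rw [← addSet_addRows he hS, mem_addSet] at hn'
  rw [Finset.mem_sdiff] at hn
  have hI : insert n S ⊆ addSet e s i lam := Finset.insert_subset hn.1 hS
  refine PartitionSeq.ext_part_s15 fun r => ?_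
  rw [addRow_part hn'.1, addRows_part (isAddable_of_subset_addSet hI),
    addRows_part (isAddable_of_subset_addSet hS), addRows_part (isAddable_of_subset_addSet hS)]
  by_cases h : r = n
  · subst h; simp [hn.2]
  · simp [h]

theorem Nval_addRows {e : ℕ} (he : 2 ≤ e) {s : ℤ} {i : ZMod e} {lam : PartitionSeq}
    {S : Finset ℕ} (hS : S ⊆ addSet e s i lam) (n : ℕ) :
    Nval e s i (addRows lam S) n = Nval e s i lam n - 2 * ((S.filter (· < n)).card : ℤ) := by
  have hA : ((Finset.range n).filter fun r => isAddable lam r ∧ addRes e s lam r = i) =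
      ((Finset.range n).filter fun r => isAddable (addRows lam S) r ∧
        addRes e s (addRows lam S) r = i) ∪ S.filter (· < n) := by
    ext r
    simp only [Finset.mem_filter, Finset.mem_union, Finset.mem_range, addable_addRows_iff he hS]
    have := fun h : r ∈ S => mem_addSet.1 (hS h)
    tauto
  have hR : ((Finset.range n).filter fun r => isRemovable (addRows lam S) r ∧
        remRes e s (addRows lam S) r = i) =
      ((Finset.range n).filter fun r => isRemovable lam r ∧
        remRes e s lam r = i) ∪ S.filter (· < n) := by
    ext r
    simp only [Finset.mem_filter, Finset.mem_union, Finset.mem_range, removable_addRows_iff he hS]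
    tauto
  rw [Nval, Nval, hA, hR, Finset.card_union_of_disjoint, Finset.card_union_of_disjoint]
  · push_cast
    ring
  · refine Finset.disjoint_left.2 fun r h1 h2 => ?_
    exact ((addable_addRows_iff he hS r).1 (Finset.mem_filter.1 h1).2).2 (Finset.mem_filter.1 h2).1
  · refine Finset.disjoint_left.2 fun r h1 h2 => ?_
    exact not_removable_of_mem_addSet he (hS (Finset.mem_filter.1 h2).1) (Finset.mem_filter.1 h1).2

theorem sum_card_filter_lt {M : Type*} [AddCommMonoid M] (S : Finset ℕ) (g : ℕ → M) :
    ∑ n ∈ S, g (S.filter (· < n)).card = ∑ k ∈ Finset.range S.card, g k := by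
  induction S using Finset.induction_on_max with
  | empty => simp
  | insert a S hmax ih =>
    have ha : a ∉ S := fun h => lt_irrefl _ (hmax a h)
    rw [Finset.sum_insert ha, Finset.card_insert_of_notMem ha, Finset.sum_range_succ, ← ih,
      add_comm]
    congr 1
    · refine Finset.sum_congr rfl fun n hn => ?_
      rw [Finset.filter_insert, if_neg (not_lt.2 (hmax n hn).le)]
    · rw [Finset.filter_insert, if_neg (lt_irrefl a), Finset.filter_true_of_mem hmax]

theorem sum_powersetCard_succ_erase {M : Type*} [AddCommMonoid M] (A : Finset ℕ) (a : ℕ)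
    (F : Finset ℕ → ℕ → M) :
    ∑ S ∈ A.powersetCard a, ∑ n ∈ A \ S, F S n =
      ∑ S ∈ A.powersetCard (a + 1), ∑ n ∈ S, F (S.erase n) n := by
  rw [Finset.sum_sigma', Finset.sum_sigma']
  refine Finset.sum_bij' (fun p _ => ⟨insert p.2 p.1, p.2⟩) (fun p _ => ⟨p.1.erase p.2, p.2⟩)
    ?_ ?_ ?_ ?_ ?_
  · rintro ⟨S, n⟩ h
    simp only [Finset.mem_sigma, Finset.mem_powersetCard, Finset.mem_sdiff] at h ⊢
    obtain ⟨⟨h1, h2⟩, h3, h4⟩ := h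
    exact ⟨⟨Finset.insert_subset h3 h1, by rw [Finset.card_insert_of_notMem h4, h2]⟩,
      Finset.mem_insert_self _ _⟩
  · rintro ⟨S, n⟩ h
    simp only [Finset.mem_sigma, Finset.mem_powersetCard, Finset.mem_sdiff] at h ⊢
    obtain ⟨⟨h1, h2⟩, h3⟩ := h
    exact ⟨⟨(Finset.erase_subset _ _).trans h1, by rw [Finset.card_erase_of_mem h3, h2]; rfl⟩,
      h1 h3, Finset.notMem_erase _ _⟩
  · rintro ⟨S, n⟩ h
    simp only [Finset.mem_sigma, Finset.mem_sdiff] at h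
    simp [Finset.erase_insert h.2.2]
  · rintro ⟨S, n⟩ h
    simp only [Finset.mem_sigma] at h
    simp [Finset.insert_erase h.2]
  · rintro ⟨S, n⟩ h
    simp only [Finset.mem_sigma, Finset.mem_sdiff] at h
    simp [Finset.erase_insert h.2.2]

/-! ### Quantum integers -/

theorem qK_ne_zero : qK ≠ 0 := RatFunc.X_ne_zero

theorem qK_pow_ne_one {n : ℕ} (hn : n ≠ 0) : qK ^ n ≠ 1 := by
  intro h
  have h1 : algebraMap (Polynomial ℚ) K (Polynomial.X ^ n) = algebraMap (Polynomial ℚ) K 1 := by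
    rw [map_pow, RatFunc.algebraMap_X, map_one]
    exact h
  have h2 := congrArg Polynomial.natDegree (RatFunc.algebraMap_injective ℚ h1)
  simp at h2
  exact hn h2

theorem qK_zpow_sub_ne_zero {n : ℕ} (hn : n ≠ 0) : qK ^ (n : ℤ) - qK ^ (-(n : ℤ)) ≠ 0 := by
  intro h
  rw [sub_eq_zero] at h
  apply qK_pow_ne_one (n := n + n) (by omega)
  have := congrArg (· * qK ^ (n : ℤ)) h
  simp only [← zpow_add₀ qK_ne_zero, neg_add_cancel, zpow_zero] at this
  rw [← this, ← zpow_natCast]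
  push_cast
  rfl

theorem qK_sub_inv_ne_zero : qK - qK⁻¹ ≠ 0 := by
  simpa using qK_zpow_sub_ne_zero one_ne_zero

theorem qFact_ne_zero (a : ℕ) : qFact a ≠ 0 :=
  Finset.prod_ne_zero_iff.2 fun k _ =>
    div_ne_zero (qK_zpow_sub_ne_zero (Nat.succ_ne_zero k)) qK_sub_inv_ne_zero

theorem qFact_succ (a : ℕ) : qFact (a + 1) = qFact a * qInt (a + 1) :=
  Finset.prod_range_succ _ _

theorem sum_qK_zpow (a : ℕ) :
    ∑ k ∈ Finset.range (a + 1), qK ^ (-2 * (k : ℤ)) = qK ^ (-(a : ℤ)) * qInt (a + 1) := by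
  have hq := qK_ne_zero
  rw [qInt, ← mul_div_assoc, eq_div_iff qK_sub_inv_ne_zero]
  induction a with
  | zero => simp
  | succ a ih =>
    rw [Finset.sum_range_succ, add_mul, ih, mul_sub, mul_sub, mul_sub, ← zpow_neg_one,
      ← zpow_add_one₀ hq, ← zpow_add₀ hq, ← zpow_add₀ hq, ← zpow_add₀ hq, ← zpow_add₀ hq,
      ← zpow_add₀ hq]
    push_cast
    ring_nf

/-! ### The divided powers -/

/-- The image of `|lam⟩` under `f_i`. -/
def fVec (e : ℕ) (s : ℤ) (i : ZMod e) (lam : PartitionSeq) : Fock :=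
  ∑ n ∈ addSet e s i lam, Finsupp.single (addRow lam n) (qK ^ Nval e s i lam n)

theorem fOp_eq_linearCombination (e : ℕ) (s : ℤ) (i : ZMod e) :
    fOp e s i = Finsupp.linearCombination K (fVec e s i) := by
  funext x
  simp only [fOp, Finsupp.linearCombination_apply, fVec, Finset.smul_sum, Finsupp.smul_single,
    smul_eq_mul, addSet]

/-- The exponent of `q` in the coefficient of `addRows lam S` in `f_i^{(a)} |lam⟩`. -/
def addWeight (e : ℕ) (s : ℤ) (i : ZMod e) (lam : PartitionSeq) (S : Finset ℕ) : ℤ :=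
  ∑ n ∈ S, Nval e s i lam n - ∑ k ∈ Finset.range S.card, (k : ℤ)

/-- The image of `|lam⟩` under `f_i^{(a)}`. -/
def divVec (e : ℕ) (s : ℤ) (i : ZMod e) (a : ℕ) (lam : PartitionSeq) : Fock :=
  ∑ S ∈ (addSet e s i lam).powersetCard a,
    Finsupp.single (addRows lam S) (qK ^ addWeight e s i lam S)

theorem linearCombination_fVec_divVec {e : ℕ} (he : 2 ≤ e) (s : ℤ) (i : ZMod e) (a : ℕ)
    (lam : PartitionSeq) :
    Finsupp.linearCombination K (fVec e s i) (divVec e s i a lam) =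
      qInt (a + 1) • divVec e s i (a + 1) lam := by
  have hq := qK_ne_zero
  have key : ∀ S ∈ (addSet e s i lam).powersetCard a,
      Finsupp.linearCombination K (fVec e s i)
        (Finsupp.single (addRows lam S) (qK ^ addWeight e s i lam S)) =
      ∑ n ∈ addSet e s i lam \ S, Finsupp.single (addRows lam (insert n S))
        (qK ^ (addWeight e s i lam S +
          (Nval e s i lam n - 2 * ((S.filter (· < n)).card : ℤ)))) := by
    intro S hS
    have hS := (Finset.mem_powersetCard.1 hS).1
    rw [Finsupp.linearCombination_single, fVec, addSet_addRows he hS, Finset.smul_sum]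
    refine Finset.sum_congr rfl fun n hn => ?_
    rw [addRow_addRows he hS hn, Finsupp.smul_single, smul_eq_mul, ← zpow_add₀ hq,
      Nval_addRows he hS]
  rw [divVec, map_sum, Finset.sum_congr rfl key, sum_powersetCard_succ_erase (addSet e s i lam) a
    fun S n => Finsupp.single (addRows lam (insert n S)) (qK ^ (addWeight e s i lam S +
          (Nval e s i lam n - 2 * ((S.filter (· < n)).card : ℤ)))), divVec, Finset.smul_sum]
  refine Finset.sum_congr rfl fun S hS => ?_
  have hcard := (Finset.mem_powersetCard.1 hS).2
  have hterm : ∀ n ∈ S, Finsupp.single (addRows lam (insert n (S.erase n)))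
        (qK ^ (addWeight e s i lam (S.erase n) +
          (Nval e s i lam n - 2 * (((S.erase n).filter (· < n)).card : ℤ)))) =
      Finsupp.single (addRows lam S) (qK ^ (addWeight e s i lam S + a) *
        qK ^ (-2 * ((S.filter (· < n)).card : ℤ))) := by
    intro n hn
    have h1 : (S.erase n).filter (· < n) = S.filter (· < n) := by
      ext m
      simp only [Finset.mem_filter, Finset.mem_erase]
      constructor
      · tauto
      · intro h; exact ⟨⟨h.2.ne, h.1⟩, h.2⟩
    rw [Finset.insert_erase hn, ← zpow_add₀ hq, h1]
    congr 2
    rw [addWeight, addWeight, Finset.card_erase_of_mem hn, hcard, ← Finset.add_sum_erase S _ hn,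
      Nat.add_sub_cancel, Finset.sum_range_succ]
    ring
  rw [Finset.sum_congr rfl hterm, ← Finsupp.single_finsetSum, ← Finset.mul_sum,
    sum_card_filter_lt S fun k => qK ^ (-2 * (k : ℤ)), hcard, sum_qK_zpow, ← mul_assoc,
    ← zpow_add₀ hq, Finsupp.smul_single, smul_eq_mul, mul_comm]
  congr 3
  ring

theorem divPow_eq_linearCombination {e : ℕ} (he : 2 ≤ e) (s : ℤ) (i : ZMod e) (a : ℕ) (x : Fock) :
    divPow e s i a x = Finsupp.linearCombination K (divVec e s i a) x := by
  have hpow : ∀ a : ℕ, (Finsupp.linearCombination K (fVec e s i)) ^ a =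
      qFact a • Finsupp.linearCombination K (divVec e s i a) := by
    intro a
    induction a with
    | zero =>
      refine Finsupp.lhom_ext fun lam c => ?_
      simp [qFact, divVec, addWeight, addRows_empty]
    | succ a ih =>
      refine Finsupp.lhom_ext fun lam c => ?_
      rw [pow_succ', ih, Module.End.mul_apply, LinearMap.smul_apply, LinearMap.smul_apply,
        Finsupp.linearCombination_single, Finsupp.linearCombination_single, map_smul, map_smul,
        linearCombination_fVec_divVec he, qFact_succ, smul_comm c, mul_smul]
  rw [divPow, fOp_eq_linearCombination, ← Module.End.pow_apply, hpow, LinearMap.smul_apply,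
    inv_smul_smul₀ (qFact_ne_zero a)]

open Classical in
theorem divPow_apply {e : ℕ} (he : 2 ≤ e) (s : ℤ) (i : ZMod e) (a : ℕ) (x : Fock)
    (nu : PartitionSeq) :
    divPow e s i a x nu = ∑ lam ∈ x.support, ∑ S ∈ (addSet e s i lam).powersetCard a,
      if addRows lam S = nu then x lam * qK ^ addWeight e s i lam S else 0 := by
  rw [divPow_eq_linearCombination he, Finsupp.linearCombination_apply, Finsupp.sum,
    Finsupp.finsetSum_apply]
  refine Finset.sum_congr rfl fun lam _ => ?_
  rw [divVec, Finset.smul_sum, Finsupp.finsetSum_apply]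
  refine Finset.sum_congr rfl fun S _ => ?_
  rw [Finsupp.smul_single, Finsupp.single_apply, smul_eq_mul]

theorem exists_of_divPow_apply_ne_zero {e : ℕ} (he : 2 ≤ e) {s : ℤ} {i : ZMod e} {a : ℕ}
    {x : Fock} {nu : PartitionSeq} (h : divPow e s i a x nu ≠ 0) :
    ∃ lam S, x lam ≠ 0 ∧ S ⊆ addSet e s i lam ∧ S.card = a ∧ addRows lam S = nu := by
  classical
  rw [divPow_apply he] at h
  obtain ⟨lam, hlam, h⟩ := Finset.exists_ne_zero_of_sum_ne_zero h
  obtain ⟨S, hS, h⟩ := Finset.exists_ne_zero_of_sum_ne_zero h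
  rw [Finset.mem_powersetCard] at hS
  refine ⟨lam, S, Finsupp.mem_support_iff.1 hlam, hS.1, hS.2, ?_⟩
  by_contra hne
  exact h (if_neg hne)

/-! ### Laurent polynomials with integer coefficients -/

/-- The subring `ℤ[q, q⁻¹]` of `ℚ(q)`. -/
def laurentSubring : Subring K := Subring.closure {qK, qK⁻¹}

theorem qK_zpow_mem_laurentSubring (n : ℤ) : qK ^ n ∈ laurentSubring := by
  have h1 : qK ∈ laurentSubring := Subring.subset_closure (by simp)
  have h2 : qK⁻¹ ∈ laurentSubring := Subring.subset_closure (by simp)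
  rcases n with n | n
  · simpa using pow_mem h1 n
  · rw [zpow_negSucc, ← inv_pow]
    exact pow_mem h2 _

theorem exists_polynomial_of_mem_laurentSubring {x : K} (hx : x ∈ laurentSubring) :
    ∃ (p : Polynomial ℤ) (n : ℕ), qK ^ n * x =
      algebraMap (Polynomial ℚ) K (Polynomial.map (Int.castRingHom ℚ) p) := by
  have hX : algebraMap (Polynomial ℚ) K Polynomial.X = qK := RatFunc.algebraMap_X
  induction hx using Subring.closure_induction with
  | mem x hx =>
    rcases hx with rfl | rfl
    · exact ⟨Polynomial.X, 0, by simp [hX]⟩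
    · exact ⟨1, 1, by simp [qK_ne_zero]⟩
  | zero => exact ⟨0, 0, by simp⟩
  | one => exact ⟨1, 0, by simp⟩
  | add x y _ _ hx hy =>
    obtain ⟨p, m, hp⟩ := hx
    obtain ⟨r, n, hr⟩ := hy
    refine ⟨Polynomial.X ^ n * p + Polynomial.X ^ m * r, m + n, ?_⟩
    simp only [Polynomial.map_add, Polynomial.map_mul, Polynomial.map_pow, Polynomial.map_X,
      map_add, map_mul, map_pow, hX, ← hp, ← hr]
    ring
  | neg x _ hx =>
    obtain ⟨p, m, hp⟩ := hx
    exact ⟨-p, m, by rw [mul_neg, hp, Polynomial.map_neg, map_neg]⟩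
  | mul x y _ _ hx hy =>
    obtain ⟨p, m, hp⟩ := hx
    obtain ⟨r, n, hr⟩ := hy
    refine ⟨p * r, m + n, ?_⟩
    rw [Polynomial.map_mul, map_mul, ← hp, ← hr]
    ring

theorem divPow_apply_mem_laurentSubring {e : ℕ} (he : 2 ≤ e) (s : ℤ) (i : ZMod e) (a : ℕ)
    {x : Fock} (hx : ∀ lam, x lam ∈ laurentSubring) (nu : PartitionSeq) :
    divPow e s i a x nu ∈ laurentSubring := by
  classical
  rw [divPow_apply he]
  refine sum_mem fun lam _ => sum_mem fun S _ => ?_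
  split_ifs
  · exact mul_mem (hx lam) (qK_zpow_mem_laurentSubring _)
  · exact zero_mem _

/-! ### Ladders -/

theorem lt_part_of_regular {d : ℕ} {μ : PartitionSeq}
    (hreg : ∀ i : ℕ, ¬(μ.part i = μ.part (i + d) ∧ 0 < μ.part i)) {m i : ℕ} (k : ℕ)
    (h : m < μ.part (i + d * k)) : m + k < μ.part i := by
  induction k generalizing i with
  | zero => simpa using h
  | succ k ih =>
    have h1 := ih (i := i + d) (by convert h using 2; ring)
    have h2 := hreg i
    have h3 := μ.antitone' i (i + d) (by omega)
    omega

/-- The diagram of a regular partition contains with a node all nodes weakly above it in earlier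
ladders or the same ladder. -/
theorem lt_part_of_ladder_le {d : ℕ} {μ : PartitionSeq}
    (hreg : ∀ i : ℕ, ¬(μ.part i = μ.part (i + d) ∧ 0 < μ.part i)) {r m r' m' : ℕ}
    (h : m < μ.part r) (hr : r' ≤ r) (hl : r' + d * m' ≤ r + d * m) : m' < μ.part r' := by
  rcases le_total m' m with hm | hm
  · exact lt_of_le_of_lt hm (lt_of_lt_of_le h (μ.antitone' _ _ hr))
  · obtain ⟨k, rfl⟩ := Nat.exists_eq_add_of_le hm
    refine lt_part_of_regular hreg k (lt_of_lt_of_le h (μ.antitone' _ _ ?_))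
    rw [mul_add] at hl
    omega

/-- All (0-based) nodes `(r, m)` of `lam` satisfy `r + (e - 1) m < l`. -/
def InLadders (e : ℕ) (lam : PartitionSeq) (l : ℕ) : Prop :=
  ∀ r m, m < lam.part r → r + (e - 1) * m < l

theorem intCast_ladder_residue {e : ℕ} (he : 2 ≤ e) (s : ℤ) (r m l : ℕ) :
    (((m : ℤ) - r + s : ℤ) : ZMod e) = ((s - l : ℤ) : ZMod e) ↔
      (e : ℤ) ∣ (r + (e - 1 : ℕ) * m : ℕ) - (l : ℤ) := by
  have : (s - l) - ((m : ℤ) - r + s) = ((r + (e - 1 : ℕ) * m : ℕ) - (l : ℤ)) - e * m := by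
    push_cast [show 1 ≤ e by omega]
    ring
  rw [ZMod.intCast_eq_intCast_iff_dvd_sub, this, dvd_sub_left (dvd_mul_right _ _)]

theorem ladder_le_of_mem_addSet {e : ℕ} (he : 2 ≤ e) {s : ℤ} {lam : PartitionSeq} {l r : ℕ}
    (h : InLadders e lam l) (hr : r ∈ addSet e s ((s - l : ℤ) : ZMod e) lam) :
    r + (e - 1) * lam.part r ≤ l := by
  obtain ⟨h1, h2⟩ := mem_addSet.1 hr
  rcases Nat.eq_zero_or_pos r with rfl | hr0
  · rcases Nat.eq_zero_or_pos (lam.part 0) with h0 | h0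
    · simp [h0]
    · have h3 := h 0 (lam.part 0 - 1) (by omega)
      rw [addRes, intCast_ladder_residue he] at h2
      obtain ⟨c, hc⟩ := h2
      have h4 : (e - 1) * lam.part 0 = (e - 1) * (lam.part 0 - 1) + (e - 1) := by
        conv_lhs => rw [show lam.part 0 = lam.part 0 - 1 + 1 by omega]
        ring
      by_contra hlt
      have hc1 : 0 < (e : ℤ) * c := by rw [← hc]; omega
      have hc2 : 0 < c := by
        by_contra hc0
        nlinarith
      have hc3 : (e : ℤ) ≤ e * c := by nlinarith
      omega
  · rcases h1 with h1 | h1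
    · omega
    · have := h (r - 1) (lam.part r) h1
      omega

theorem InLadders.addRows {e : ℕ} (he : 2 ≤ e) {s : ℤ} {lam : PartitionSeq} {l : ℕ}
    (h : InLadders e lam l) {S : Finset ℕ} (hS : S ⊆ addSet e s ((s - l : ℤ) : ZMod e) lam) :
    InLadders e (addRows lam S) (l + 1) := by
  intro r m hm
  rw [addRows_part (isAddable_of_subset_addSet hS)] at hm
  by_cases hmr : m < lam.part r
  · exact (h r m hmr).trans (Nat.lt_succ_self l)
  · by_cases hr : r ∈ S
    · have := ladder_le_of_mem_addSet he h (hS hr)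
      simp only [hr, if_true] at hm
      rw [show m = lam.part r by omega]
      omega
    · simp only [hr, if_false] at hm
      omega

/-- The part of `μ` contained in the first `l` ladders. -/
def ladderTrunc (e : ℕ) (μ : PartitionSeq) (l : ℕ) : PartitionSeq where
  part r := min (μ.part r) ((l - r + (e - 2)) / (e - 1))
  antitone' i j hij := min_le_min (μ.antitone' i j hij) (Nat.div_le_div_right (by omega))
  finite' := ⟨partBound μ, fun i hi => by simp [part_eq_zero_of_partBound_le μ hi]⟩

theorem lt_ladderTrunc_part {e : ℕ} (he : 2 ≤ e) (μ : PartitionSeq) (l r m : ℕ) :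
    m < (ladderTrunc e μ l).part r ↔ m < μ.part r ∧ r + (e - 1) * m < l := by
  simp only [ladderTrunc, lt_min_iff, and_congr_right_iff]
  intro _
  rw [← Nat.succ_le_iff, Nat.le_div_iff_mul_le (by omega), Nat.succ_mul, mul_comm m]
  omega

theorem PartitionSeq.ext_lt {lam nu : PartitionSeq} (h : ∀ r m, m < lam.part r ↔ m < nu.part r) :
    lam = nu :=
  PartitionSeq.ext_part_s15 fun r => le_antisymm
    (le_of_not_gt fun hlt => lt_irrefl _ ((h r _).1 hlt))
    (le_of_not_gt fun hlt => lt_irrefl _ ((h r _).2 hlt))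

theorem inLadders_ladderTrunc {e : ℕ} (he : 2 ≤ e) (μ : PartitionSeq) (l : ℕ) :
    InLadders e (ladderTrunc e μ l) l := fun r m h => ((lt_ladderTrunc_part he μ l r m).1 h).2

theorem ladderTrunc_eq_self {e : ℕ} (he : 2 ≤ e) {μ : PartitionSeq} {l : ℕ}
    (h : InLadders e μ l) : ladderTrunc e μ l = μ :=
  PartitionSeq.ext_lt fun r m => by
    rw [lt_ladderTrunc_part he, and_iff_left_iff_imp]
    exact h r m

theorem ladderTrunc_zero {e : ℕ} (he : 2 ≤ e) (μ : PartitionSeq) :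
    ladderTrunc e μ 0 = emptyPart :=
  PartitionSeq.ext_lt fun r m => by
    rw [lt_ladderTrunc_part he]
    simp [emptyPart]

/-- The rows containing a node of `μ` in the ladder of index `l` (0-based). -/
def ladderRows (e : ℕ) (μ : PartitionSeq) (l : ℕ) : Finset ℕ :=
  (Finset.range (l + 1)).filter fun r =>
    r + (e - 1) * (ladderTrunc e μ l).part r = l ∧ (ladderTrunc e μ l).part r < μ.part r

theorem mem_ladderRows {e : ℕ} {μ : PartitionSeq} {l r : ℕ} : r ∈ ladderRows e μ l ↔
    r + (e - 1) * (ladderTrunc e μ l).part r = l ∧ (ladderTrunc e μ l).part r < μ.part r := by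
  simp only [ladderRows, Finset.mem_filter, Finset.mem_range, and_iff_right_iff_imp]
  rintro ⟨h, -⟩
  have := Nat.zero_le ((e - 1) * (ladderTrunc e μ l).part r)
  omega

theorem ladderTrunc_part_of_ladder_eq {e : ℕ} (he : 2 ≤ e) {μ : PartitionSeq} {l r m : ℕ}
    (hm : m < μ.part r) (hl : r + (e - 1) * m = l) : (ladderTrunc e μ l).part r = m := by
  have hd : 0 < e - 1 := by omega
  refine le_antisymm (le_of_not_gt fun h => ?_) (le_of_not_gt fun h => ?_)
  · have := ((lt_ladderTrunc_part he μ l r m).1 h).2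
    omega
  · refine lt_irrefl _ ((lt_ladderTrunc_part he μ l r _).2 ⟨h.trans hm, ?_⟩)
    have := Nat.mul_lt_mul_of_pos_left h hd
    omega

theorem card_ladderRows {e : ℕ} (he : 2 ≤ e) (μ : PartitionSeq) (l : ℕ) :
    (ladderRows e μ l).card = ladderCount e μ (l + 1) := by
  symm
  refine Finset.card_bij' (fun p _ => p.1 - 1)
    (fun r _ => (r + 1, (ladderTrunc e μ l).part r + 1)) ?_ ?_ ?_ ?_
  · rintro ⟨i, j⟩ h
    simp only [Finset.mem_filter, Finset.mem_product, Finset.mem_Icc] at h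
    have h1 : i - 1 + (e - 1) * (j - 1) = l := by omega
    have h2 : j - 1 < μ.part (i - 1) := by omega
    rw [mem_ladderRows, ladderTrunc_part_of_ladder_eq he h2 h1]
    exact ⟨h1, h2⟩
  · intro r h
    rw [mem_ladderRows] at h
    have : (ladderTrunc e μ l).part r ≤ (e - 1) * (ladderTrunc e μ l).part r :=
      Nat.le_mul_of_pos_left _ (by omega)
    simp only [Finset.mem_filter, Finset.mem_product, Finset.mem_Icc, Nat.add_sub_cancel]
    omega
  · rintro ⟨i, j⟩ h
    simp only [Finset.mem_filter, Finset.mem_product, Finset.mem_Icc] at h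
    have h1 : i - 1 + (e - 1) * (j - 1) = l := by omega
    have h2 : j - 1 < μ.part (i - 1) := by omega
    rw [ladderTrunc_part_of_ladder_eq he h2 h1, Prod.mk.injEq]
    omega
  · intro r h
    simp

theorem ladderRows_subset_addSet {e : ℕ} (he : 2 ≤ e) (s : ℤ) (μ : PartitionSeq) (l : ℕ) :
    ladderRows e μ l ⊆ addSet e s ((s - l : ℤ) : ZMod e) (ladderTrunc e μ l) := by
  intro r hr
  rw [mem_ladderRows] at hr
  rw [mem_addSet]
  constructor
  · rcases Nat.eq_zero_or_pos r with h | h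
    · exact Or.inl h
    · refine Or.inr ((lt_ladderTrunc_part he μ l _ _).2 ⟨lt_of_lt_of_le hr.2
        (μ.antitone' _ _ (by omega)), ?_⟩)
      omega
  · rw [addRes, intCast_ladder_residue he, hr.1]
    simp

theorem addRows_ladderRows {e : ℕ} (he : 2 ≤ e) (μ : PartitionSeq) (l : ℕ) :
    addRows (ladderTrunc e μ l) (ladderRows e μ l) = ladderTrunc e μ (l + 1) := by
  refine PartitionSeq.ext_lt fun r m => ?_
  rw [addRows_part (isAddable_of_subset_addSet (ladderRows_subset_addSet he 0 μ l)),
    lt_ladderTrunc_part he]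
  have h1 := lt_ladderTrunc_part he μ l r m
  by_cases hr : r ∈ ladderRows e μ l
  · rw [if_pos hr]
    rw [mem_ladderRows] at hr
    constructor
    · intro h
      rcases Nat.lt_succ_iff_lt_or_eq.1 h with h | h
      · have := h1.1 h
        omega
      · rw [h]
        omega
    · rintro ⟨h2, h3⟩
      rcases Nat.lt_succ_iff_lt_or_eq.1 h3 with h | h
      · exact (h1.2 ⟨h2, h⟩).trans (Nat.lt_succ_self _)
      · rw [ladderTrunc_part_of_ladder_eq he h2 h]
        exact Nat.lt_succ_self _
  · rw [if_neg hr, add_zero, h1]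
    refine and_congr_right fun h2 => ⟨fun h => h.trans (Nat.lt_succ_self _), fun h3 => ?_⟩
    refine lt_of_le_of_ne (Nat.lt_succ_iff.1 h3) fun h => hr ?_
    rw [mem_ladderRows, ladderTrunc_part_of_ladder_eq he h2 h]
    exact ⟨h, h2⟩

theorem eq_of_addRows_eq_ladderTrunc_succ {e : ℕ} (he : 2 ≤ e) {s : ℤ} {μ lam : PartitionSeq}
    {l : ℕ} {S : Finset ℕ} (hlam : InLadders e lam l)
    (hS : S ⊆ addSet e s ((s - l : ℤ) : ZMod e) lam) (hcard : S.card = ladderCount e μ (l + 1))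
    (heq : addRows lam S = ladderTrunc e μ (l + 1)) :
    lam = ladderTrunc e μ l ∧ S = ladderRows e μ l := by
  have hp := addRows_part (isAddable_of_subset_addSet hS)
  have hp' := addRows_part (isAddable_of_subset_addSet (ladderRows_subset_addSet he s μ l))
  rw [addRows_ladderRows he, ← heq] at hp'
  have hle : ∀ r, lam.part r ≤ (ladderTrunc e μ l).part r := fun r => by
    by_contra hlt
    rw [not_le] at hlt
    have h1 : (ladderTrunc e μ l).part r < (addRows lam S).part r := by rw [hp]; omega
    rw [heq, lt_ladderTrunc_part he] at h1
    exact lt_irrefl _ ((lt_ladderTrunc_part he μ l r _).2 ⟨h1.1, hlam r _ hlt⟩)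
  have hsub : ladderRows e μ l ⊆ S := fun r hr => by
    by_contra hrS
    have h1 := hp r
    rw [hp' r, if_pos hr, if_neg hrS] at h1
    have := hle r
    omega
  have hSeq := Finset.eq_of_subset_of_card_le hsub (by rw [hcard, card_ladderRows he])
  refine ⟨PartitionSeq.ext_part_s15 fun r => ?_, hSeq.symm⟩
  have h1 := hp r
  rw [hp' r, hSeq] at h1
  omega

theorem addWeight_ladderRows {e : ℕ} (he : 2 ≤ e) (s : ℤ) {μ : PartitionSeq}
    (hreg : ∀ i : ℕ, ¬(μ.part i = μ.part (i + (e - 1)) ∧ 0 < μ.part i)) (l : ℕ) :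
    addWeight e s ((s - l : ℤ) : ZMod e) (ladderTrunc e μ l) (ladderRows e μ l) = 0 := by
  rw [addWeight, ← sum_card_filter_lt _ fun k => (k : ℤ), sub_eq_zero]
  refine Finset.sum_congr rfl fun n hn => ?_
  rw [mem_ladderRows] at hn
  have hA : (Finset.range n).filter (fun r => isAddable (ladderTrunc e μ l) r ∧
      addRes e s (ladderTrunc e μ l) r = ((s - l : ℤ) : ZMod e)) =
      (ladderRows e μ l).filter (· < n) := by
    ext r
    simp only [Finset.mem_filter, Finset.mem_range, ← mem_addSet]
    rw [and_comm]
    refine and_congr_left fun hrn =>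
      ⟨fun hr => ?_, fun hr => ladderRows_subset_addSet he s μ l hr⟩
    have h1 := ladder_le_of_mem_addSet he (inLadders_ladderTrunc he μ l) hr
    have h2 : (ladderTrunc e μ l).part r < μ.part r :=
      lt_part_of_ladder_le hreg hn.2 hrn.le (by omega)
    refine mem_ladderRows.2 ⟨le_antisymm h1 (le_of_not_gt fun h => ?_), h2⟩
    exact lt_irrefl _ ((lt_ladderTrunc_part he μ l r _).2 ⟨h2, h⟩)
  have hR : (Finset.range n).filter (fun r => isRemovable (ladderTrunc e μ l) r ∧
      remRes e s (ladderTrunc e μ l) r = ((s - l : ℤ) : ZMod e)) = ∅ := by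
    refine Finset.filter_eq_empty_iff.2 fun r hrn hr => ?_
    rw [Finset.mem_range] at hrn
    obtain ⟨h1, h2⟩ := hr
    have hpos : 0 < (ladderTrunc e μ l).part r := lt_of_le_of_lt (Nat.zero_le _) h1
    obtain ⟨m, hm⟩ := Nat.exists_eq_succ_of_ne_zero hpos.ne'
    have h3 := inLadders_ladderTrunc he μ l r m (by omega)
    have h4 : (((m : ℤ) - r + s : ℤ) : ZMod e) = ((s - l : ℤ) : ZMod e) := by
      rw [← h2, remRes, hm]
      congr 1
      push_cast
      ring
    rw [intCast_ladder_residue he, ← dvd_neg, neg_sub] at h4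
    have h5 := Int.le_of_dvd (by omega) h4
    have h6 : r + (e - 1) * (m + 1) < l := by
      rw [mul_add]
      omega
    have h7 : m + 1 < μ.part r := lt_part_of_ladder_le hreg hn.2 hrn.le (by omega)
    have h8 := (lt_ladderTrunc_part he μ l r _).2 ⟨h7, h6⟩
    omega
  rw [Nval, hA, hR]
  simp

/-! ### Counting nodes -/

/-- The (0-based) nodes of the Young diagram of `lam`. -/
def cells (lam : PartitionSeq) : Finset (ℕ × ℕ) :=
  (Finset.range (partBound lam) ×ˢ Finset.range (lam.part 0)).filter fun p => p.2 < lam.part p.1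

theorem mem_cells {lam : PartitionSeq} {p : ℕ × ℕ} : p ∈ cells lam ↔ p.2 < lam.part p.1 := by
  simp only [cells, Finset.mem_filter, Finset.mem_product, Finset.mem_range,
    and_iff_right_iff_imp]
  intro h
  refine ⟨lt_of_not_ge fun hge => ?_, lt_of_lt_of_le h (lam.antitone' _ _ (Nat.zero_le _))⟩
  rw [part_eq_zero_of_partBound_le lam hge] at h
  omega

theorem card_cells_filter_fst_lt (lam : PartitionSeq) (j : ℕ) :
    ((cells lam).filter fun p => p.1 < j).card = ∑ i ∈ Finset.range j, lam.part i := by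
  have h : ∀ i ∈ Finset.range j, lam.part i = (Finset.range (lam.part i)).card := by simp
  rw [Finset.sum_congr rfl h, ← Finset.card_sigma]
  refine Finset.card_bij' (fun p _ => ⟨p.1, p.2⟩) (fun p _ => (p.1, p.2)) ?_ ?_ ?_ ?_
  · intro p hp
    simpa [mem_cells, and_comm] using hp
  · intro p hp
    simpa [mem_cells, and_comm] using hp
  · intro p _; rfl
  · intro p _; rfl

/-- The nodes of `lam` lying in the ladders of (0-based) index at least `k`. -/
def cellsFrom (e : ℕ) (lam : PartitionSeq) (k : ℕ) : Finset (ℕ × ℕ) :=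
  (cells lam).filter fun p => k ≤ p.1 + (e - 1) * p.2

theorem card_cellsFrom_addRows (e : ℕ) {lam : PartitionSeq} {S : Finset ℕ}
    (hS : ∀ r ∈ S, isAddable lam r) (k : ℕ) :
    (cellsFrom e (addRows lam S) k).card =
      (cellsFrom e lam k).card + (S.filter fun r => k ≤ r + (e - 1) * lam.part r).card := by
  have himg : cellsFrom e (addRows lam S) k = cellsFrom e lam k ∪
      (S.filter fun r => k ≤ r + (e - 1) * lam.part r).image fun r => (r, lam.part r) := by
    ext ⟨r, m⟩
    simp only [cellsFrom, Finset.mem_filter, mem_cells, addRows_part hS, Finset.mem_union,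
      Finset.mem_image, Prod.mk.injEq]
    constructor
    · rintro ⟨h1, h2⟩
      by_cases h3 : m < lam.part r
      · exact Or.inl ⟨h3, h2⟩
      · by_cases hr : r ∈ S
        · rw [if_pos hr] at h1
          obtain rfl : m = lam.part r := by omega
          exact Or.inr ⟨r, ⟨hr, h2⟩, rfl, rfl⟩
        · rw [if_neg hr] at h1
          omega
    · rintro (⟨h1, h2⟩ | ⟨r', ⟨h1, h2⟩, rfl, rfl⟩)
      · exact ⟨by omega, h2⟩
      · exact ⟨by rw [if_pos h1]; omega, h2⟩
  rw [himg, Finset.card_union_of_disjoint, Finset.card_image_of_injective]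
  · exact fun a b h => (Prod.mk.inj h).1
  · refine Finset.disjoint_left.2 fun p h1 h2 => ?_
    obtain ⟨r, -, rfl⟩ := Finset.mem_image.1 h2
    exact lt_irrefl _ (mem_cells.1 (Finset.mem_filter.1 h1).1)

theorem card_cellsFrom_addRows_le {e : ℕ} (he : 2 ≤ e) {s : ℤ} {μ lam : PartitionSeq} {l : ℕ}
    {S : Finset ℕ} (hlam : InLadders e lam l)
    (hS : S ⊆ addSet e s ((s - l : ℤ) : ZMod e) lam) (hcard : S.card = ladderCount e μ (l + 1))
    {k : ℕ} (hk : (cellsFrom e lam k).card ≤ (cellsFrom e (ladderTrunc e μ l) k).card) :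
    (cellsFrom e (addRows lam S) k).card ≤ (cellsFrom e (ladderTrunc e μ (l + 1)) k).card := by
  rcases le_or_gt k l with hkl | hkl
  · rw [← addRows_ladderRows he, card_cellsFrom_addRows e (isAddable_of_subset_addSet hS),
      card_cellsFrom_addRows e (isAddable_of_subset_addSet (ladderRows_subset_addSet he s μ l))]
    refine add_le_add hk ((Finset.card_filter_le _ _).trans ?_)
    rw [hcard, ← card_ladderRows he, Finset.filter_true_of_mem]
    intro r hr
    rw [(mem_ladderRows.1 hr).1]
    exact hkl
  · have : cellsFrom e (addRows lam S) k = ∅ := by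
      refine Finset.filter_eq_empty_iff.2 fun p hp => ?_
      have := hlam.addRows he hS _ _ (mem_cells.1 hp)
      omega
    simp [this]

theorem sum_part_le_of_card_cellsFrom_le {e : ℕ} {μ ν : PartitionSeq}
    (hreg : ∀ i : ℕ, ¬(μ.part i = μ.part (i + (e - 1)) ∧ 0 < μ.part i))
    (h : ∀ k, (cellsFrom e ν k).card ≤ (cellsFrom e μ k).card) (j : ℕ) :
    ∑ i ∈ Finset.range j, ν.part i ≤ ∑ i ∈ Finset.range j, μ.part i := by
  classical
  have hex : ∃ k, ∀ p ∈ cellsFrom e μ k, p.1 < j := by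
    refine ⟨(cells μ).sup (fun p => p.1 + (e - 1) * p.2) + 1, fun p hp => ?_⟩
    obtain ⟨h1, h2⟩ := Finset.mem_filter.1 hp
    have := Finset.le_sup (f := fun p : ℕ × ℕ => p.1 + (e - 1) * p.2) h1
    omega
  obtain ⟨k, hk, hmin⟩ : ∃ k, (∀ p ∈ cellsFrom e μ k, p.1 < j) ∧
      ∀ k' < k, ¬∀ p ∈ cellsFrom e μ k', p.1 < j :=
    ⟨Nat.find hex, Nat.find_spec hex, fun _ => Nat.find_min hex⟩
  have hin : ∀ r m, r < j → r + (e - 1) * m < k → m < μ.part r := by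
    intro r m hr hrm
    have hlast := hmin (k - 1) (by omega)
    push Not at hlast
    obtain ⟨p, hp, hpj⟩ := hlast
    obtain ⟨h1, h2⟩ := Finset.mem_filter.1 hp
    exact lt_part_of_ladder_le hreg (mem_cells.1 h1) (by omega) (by omega)
  rw [← card_cells_filter_fst_lt, ← card_cells_filter_fst_lt]
  have hν : (cells ν).filter (fun p => p.1 < j) ⊆
      ((cells μ).filter fun p => p.1 < j ∧ p.1 + (e - 1) * p.2 < k) ∪ cellsFrom e ν k := by
    intro p hp
    obtain ⟨h1, h2⟩ := Finset.mem_filter.1 hp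
    rw [Finset.mem_union, cellsFrom, Finset.mem_filter, Finset.mem_filter]
    rcases lt_or_ge (p.1 + (e - 1) * p.2) k with h3 | h3
    · exact Or.inl ⟨mem_cells.2 (hin _ _ h2 h3), h2, h3⟩
    · exact Or.inr ⟨h1, h3⟩
  have hμ : ((cells μ).filter fun p => p.1 < j ∧ p.1 + (e - 1) * p.2 < k) ∪ cellsFrom e μ k ⊆
      (cells μ).filter fun p => p.1 < j := by
    intro p hp
    rcases Finset.mem_union.1 hp with hp | hp
    · obtain ⟨h1, h2⟩ := Finset.mem_filter.1 hp
      exact Finset.mem_filter.2 ⟨h1, h2.1⟩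
    · exact Finset.mem_filter.2 ⟨(Finset.mem_filter.1 hp).1, hk p hp⟩
  refine (Finset.card_le_card hν).trans ((Finset.card_union_le _ _).trans
    ((add_le_add_right (h k) _).trans ?_))
  rw [← Finset.card_union_of_disjoint]
  · exact Finset.card_le_card hμ
  · refine Finset.disjoint_left.2 fun p h1 h2 => ?_
    have h3 := (Finset.mem_filter.1 h1).2.2
    have h4 := (Finset.mem_filter.1 h2).2
    omega

/-! ### The vectors obtained from the first ladders -/

/-- The vector obtained from the empty partition by applying the divided powers for the first `l`
ladders, including the empty ones. -/
def ladderVec (e : ℕ) (s : ℤ) (μ : PartitionSeq) : ℕ → Fock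
  | 0 => Finsupp.single emptyPart 1
  | l + 1 => divPow e s ((s - l : ℤ) : ZMod e) (ladderCount e μ (l + 1)) (ladderVec e s μ l)

theorem ladderVec_apply_mem_laurentSubring {e : ℕ} (he : 2 ≤ e) (s : ℤ) (μ : PartitionSeq)
    (l : ℕ) (ν : PartitionSeq) : ladderVec e s μ l ν ∈ laurentSubring := by
  classical
  induction l generalizing ν with
  | zero =>
    rw [ladderVec, Finsupp.single_apply]
    split_ifs
    · exact one_mem _
    · exact zero_mem _
  | succ l ih => exact divPow_apply_mem_laurentSubring he _ _ _ ih ν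

theorem ladderVec_support {e : ℕ} (he : 2 ≤ e) (s : ℤ) (μ : PartitionSeq) (l : ℕ)
    {ν : PartitionSeq} (h : ladderVec e s μ l ν ≠ 0) :
    InLadders e ν l ∧
      ∀ k, (cellsFrom e ν k).card ≤ (cellsFrom e (ladderTrunc e μ l) k).card := by
  classical
  induction l generalizing ν with
  | zero =>
    rw [ladderVec, Finsupp.single_apply, ne_eq, ite_eq_right_iff, Classical.not_imp] at h
    rw [ladderTrunc_zero he, ← h.1]
    refine ⟨fun r m hm => ?_, fun k => le_rfl⟩
    simp [emptyPart] at hm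
  | succ l ih =>
    obtain ⟨lam, S, hlam, hS, hcard, rfl⟩ := exists_of_divPow_apply_ne_zero he h
    obtain ⟨h1, h2⟩ := ih hlam
    exact ⟨h1.addRows he hS, fun k => card_cellsFrom_addRows_le he h1 hS hcard (h2 k)⟩

theorem ladderVec_apply_ladderTrunc {e : ℕ} (he : 2 ≤ e) (s : ℤ) {μ : PartitionSeq}
    (hreg : ∀ i : ℕ, ¬(μ.part i = μ.part (i + (e - 1)) ∧ 0 < μ.part i)) (l : ℕ) :
    ladderVec e s μ l (ladderTrunc e μ l) = 1 := by
  classical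
  induction l with
  | zero => rw [ladderTrunc_zero he, ladderVec, Finsupp.single_eq_same]
  | succ l ih =>
    have huniq : ∀ lam ∈ (ladderVec e s μ l).support,
        ∀ S ∈ (addSet e s ((s - l : ℤ) : ZMod e) lam).powersetCard (ladderCount e μ (l + 1)),
        addRows lam S = ladderTrunc e μ (l + 1) →
          lam = ladderTrunc e μ l ∧ S = ladderRows e μ l := by
      intro lam hlam S hS heq
      rw [Finset.mem_powersetCard] at hS
      exact eq_of_addRows_eq_ladderTrunc_succ he
        (ladderVec_support he s μ l (Finsupp.mem_support_iff.1 hlam)).1 hS.1 hS.2 heq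
    have hmem : ladderTrunc e μ l ∈ (ladderVec e s μ l).support := by
      rw [Finsupp.mem_support_iff, ih]
      exact one_ne_zero
    rw [ladderVec, divPow_apply he, Finset.sum_eq_single_of_mem _ hmem,
      Finset.sum_eq_single_of_mem (ladderRows e μ l)]
    · rw [if_pos (addRows_ladderRows he μ l), ih, addWeight_ladderRows he s hreg, zpow_zero,
        mul_one]
    · exact Finset.mem_powersetCard.2 ⟨ladderRows_subset_addSet he s μ l, card_ladderRows he μ l⟩
    · exact fun S hS hne => if_neg fun heq => hne (huniq _ hmem S hS heq).2
    · exact fun lam hlam hne => Finset.sum_eq_zero fun S hS =>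
        if_neg fun heq => hne (huniq lam hlam S hS heq).1

theorem divPow_zero (e : ℕ) (s : ℤ) (i : ZMod e) (x : Fock) : divPow e s i 0 x = x := by
  simp [divPow, qFact]

theorem foldl_filter_of_forall_eq_self {α β : Type*} (g : β → α → β) (p : α → Bool)
    (h : ∀ a, p a = false → ∀ x, g x a = x) (L : List α) (x : β) :
    (L.filter p).foldl g x = L.foldl g x := by
  induction L generalizing x with
  | nil => rfl
  | cons a L ih =>
    cases hp : p a
    · rw [List.filter_cons_of_neg (by simp [hp]), ih, List.foldl_cons, h a hp]
    · rw [List.filter_cons_of_pos hp, List.foldl_cons, List.foldl_cons, ih]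

theorem ladderVec_eq_foldl (e : ℕ) (s : ℤ) (μ : PartitionSeq) (l : ℕ) :
    ladderVec e s μ l = ((List.range l).map (· + 1)).foldl
      (fun x (k : ℕ) => divPow e s ((s + 1 - (k : ℤ) : ℤ) : ZMod e) (ladderCount e μ k) x)
      (Finsupp.single emptyPart 1) := by
  induction l with
  | zero => rfl
  | succ l ih =>
    rw [List.range_succ, List.map_append, List.foldl_append, ← ih, ladderVec]
    simp only [List.map_cons, List.map_nil, List.foldl_cons, List.foldl_nil]
    congr 2
    push_cast
    ring

theorem foldl_ladders_eq_ladderVec (e : ℕ) (s : ℤ) (μ : PartitionSeq) {t : ℕ} {ll : Fin t → ℕ}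
    (hll : StrictMono ll) (hlset : {l : ℕ | 1 ≤ l ∧ ladderCount e μ l ≠ 0} = Set.range ll)
    {M : ℕ} (hM : ∀ k, ll k ≤ M) :
    (List.finRange t).foldl
        (fun x k => divPow e s ((s + 1 - (ll k : ℤ) : ℤ) : ZMod e) (ladderCount e μ (ll k)) x)
        (Finsupp.single emptyPart 1) = ladderVec e s μ M := by
  have hlist : (List.finRange t).map ll =
      ((List.range M).map (· + 1)).filter fun l => decide (ladderCount e μ l ≠ 0) := by
    refine List.Perm.eq_of_pairwise (le := (· < ·)) (fun a b _ _ h1 h2 => absurd h1 h2.asymm)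
      ?_ ?_ ?_
    · exact List.pairwise_map.2 ((List.pairwise_lt_finRange t).imp fun h => hll h)
    · exact (List.pairwise_map.2 (List.pairwise_lt_range.imp fun h => by omega)).filter _
    · rw [List.perm_ext_iff_of_nodup ((List.nodup_finRange t).map hll.injective)
        ((List.nodup_range.map (add_left_injective 1)).filter _)]
      intro l
      have hl : (1 ≤ l ∧ ladderCount e μ l ≠ 0) ↔ ∃ k, ll k = l := by
        have := Set.ext_iff.1 hlset l
        simpa using this
      simp only [List.mem_map, List.mem_finRange, true_and, List.mem_filter, List.mem_range,
        decide_eq_true_eq]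
      rw [← hl]
      constructor
      · intro h
        obtain ⟨k, rfl⟩ := hl.1 h
        exact ⟨⟨ll k - 1, by have := hM k; omega, by omega⟩, h.2⟩
      · rintro ⟨⟨a, _, rfl⟩, h⟩
        exact ⟨by omega, h⟩
  rw [ladderVec_eq_foldl, ← foldl_filter_of_forall_eq_self _
    (fun l => decide (ladderCount e μ l ≠ 0)), ← hlist, List.foldl_map]
  intro l hl x
  have h0 : ladderCount e μ l = 0 := by simpa using hl
  rw [h0, divPow_zero]

/-- Let `e ≥ 2`, `s ∈ ℤ`, and let `μ` be an `e`-regular partition.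
Let `l₁ < … < l_t` be the indices of the non-empty ladders of `μ`, `a_k = |ℒ_{l_k} ∩ [μ]|`
and `i_k = (s + 1 − l_k) mod e`.  Writing `f_{i_t}^{(a_t)} ⋯ f_{i_1}^{(a_1)} |∅⟩ = Σ_ν a_ν |ν⟩`,
every `a_ν` is a Laurent polynomial with integer coefficients (i.e. `q^nn · a_ν` is the image
of an integer polynomial for some `nn`), `a_μ = 1`, and `a_ν = 0` unless `μ ⊵ ν`. -/
theorem llt_auxiliary_vector (e : ℕ) (he : 2 ≤ e) (s : ℤ) (μ : PartitionSeq)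
    (hreg : ∀ i : ℕ, ¬(μ.part i = μ.part (i + (e - 1)) ∧ 0 < μ.part i))
    (t : ℕ) (ll : Fin t → ℕ) (hll : StrictMono ll)
    (hlset : {l : ℕ | 1 ≤ l ∧ ladderCount e μ l ≠ 0} = Set.range ll) :
    ∀ A : Fock,
      A = (List.finRange t).foldl
          (fun x k => divPow e s (((s + 1 - (ll k : ℤ) : ℤ)) : ZMod e)
            (ladderCount e μ (ll k)) x)
          (Finsupp.single emptyPart 1) →
      (∀ ν : PartitionSeq, ∃ (p : Polynomial ℤ) (nn : ℕ),
          qK ^ nn * A ν =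
            algebraMap (Polynomial ℚ) K (Polynomial.map (Int.castRingHom ℚ) p)) ∧
      A μ = 1 ∧
      (∀ ν : PartitionSeq, A ν ≠ 0 →
        ∀ j : ℕ, ∑ i ∈ Finset.range j, ν.part i ≤ ∑ i ∈ Finset.range j, μ.part i) := by
  intro A hA
  obtain ⟨M₀, hM₀⟩ : ∃ M₀, InLadders e μ M₀ := by
    refine ⟨partBound μ + (e - 1) * μ.part 0, fun r m hm => ?_⟩
    have h1 : r < partBound μ := lt_of_not_ge fun h => by
      rw [part_eq_zero_of_partBound_le μ h] at hm
      omega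
    have h2 : m ≤ μ.part 0 := hm.le.trans (μ.antitone' 0 r (Nat.zero_le r))
    exact add_lt_add_of_lt_of_le h1 (Nat.mul_le_mul_left _ h2)
  have hM : InLadders e μ (M₀ + ∑ k, ll k) := fun r m hm =>
    (hM₀ r m hm).trans_le (Nat.le_add_right _ _)
  rw [foldl_ladders_eq_ladderVec e s μ hll hlset (M := M₀ + ∑ k, ll k) fun k =>
    (Finset.single_le_sum (f := ll) (fun _ _ => Nat.zero_le _) (Finset.mem_univ k)).trans
      (Nat.le_add_left _ _)] at hA
  subst hA
  refine ⟨fun ν => exists_polynomial_of_mem_laurentSubring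
    (ladderVec_apply_mem_laurentSubring he s μ _ ν), ?_, fun ν hν => ?_⟩
  · have h := ladderVec_apply_ladderTrunc he s hreg (M₀ + ∑ k, ll k)
    rwa [ladderTrunc_eq_self he hM] at h
  · have h := (ladderVec_support he s μ _ hν).2
    rw [ladderTrunc_eq_self he hM] at h
    exact sum_part_le_of_card_cellsFrom_le hreg h

end
end
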